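/- arXiv:2008.10883 — 2 statements merged into one kernel-verified Lean document; each statement's English description precedes it below -/
import Mathlib

section
/- Let a < η₁, let V : [a, η₁] → ℝ be twice continuously differentiable with V'(η) > 0 and V(η) > 0 for all η, and let g : [a, η₁] → ℝ be continuously differentiable with g(η) > 0 for all η. For h₀ ∈ (√(V(a)), √(V(η₁))), let η₀(h₀) denote the unique point in (a, η₁) with V(η₀(h₀)) = h₀², and define Ẽ(h₀) := ∫_{η₀(h₀)}^{η₁} (1/√(g(η)))·V(η)/√(V(η) − h₀²) dη and R̃(h₀) := ∫_{η₀(h₀)}^{η₁} (1/√(g(η)))·h₀/√(V(η) − h₀²) dη (both improper integrals converge). Then Ẽ and R̃ are differentiable on (√(V(a)), √(V(η₁))) and Ẽ'(h₀) = h₀ · R̃'(h₀) for every such h₀. -/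
open MeasureTheory
open Set Filter Topology

/-- Interior points of the segment from `s` to `q` lie in `(p, q)`. -/
theorem add_sub_mul_mem_Ioo {p q s t : ℝ} (hs : s ∈ Ioo p q) (ht : t ∈ Ioo (0 : ℝ) 1) :
    s + (q - s) * t ∈ Ioo p q := by
  have h₁ := mul_pos (sub_pos.2 hs.2) ht.1
  have h₂ := mul_pos (sub_pos.2 hs.2) (sub_pos.2 ht.2)
  exact ⟨by linarith [hs.1], by linarith⟩

theorem integrableOn_comp_segment_mul {p q s M : ℝ} {f k : ℝ → ℝ}
    (hf : ContinuousOn f (Ioo p q)) (hM : ∀ v ∈ Ioo p q, |f v| ≤ M)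
    (hk : IntegrableOn k (Ioo 0 1)) (hs : s ∈ Ioo p q) :
    IntegrableOn (fun t => f (s + (q - s) * t) * k t) (Ioo 0 1) := by
  have hmem : MapsTo (fun t => s + (q - s) * t) (Ioo (0 : ℝ) 1) (Ioo p q) :=
    fun t ht => add_sub_mul_mem_Ioo hs ht
  refine Integrable.bdd_mul (c := M) hk
    ((hf.comp (by fun_prop) hmem).aestronglyMeasurable measurableSet_Ioo) ?_
  exact ae_restrict_of_forall_mem measurableSet_Ioo fun t ht => hM _ (hmem ht)

theorem hasDerivAt_integral_comp_segment_mul {p q s M : ℝ} {f f' k : ℝ → ℝ}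
    (hf : ∀ v ∈ Ioo p q, HasDerivAt f (f' v) v) (hf' : ContinuousOn f' (Ioo p q))
    (hM : ∀ v ∈ Ioo p q, |f v| ≤ M) (hM' : ∀ v ∈ Ioo p q, |f' v| ≤ M)
    (hk : IntegrableOn k (Ioo 0 1)) (hs : s ∈ Ioo p q) :
    IntegrableOn (fun t => f' (s + (q - s) * t) * (1 - t) * k t) (Ioo 0 1) ∧
    HasDerivAt (fun x => ∫ t in Ioo (0 : ℝ) 1, f (x + (q - x) * t) * k t)
      (∫ t in Ioo (0 : ℝ) 1, f' (s + (q - s) * t) * (1 - t) * k t) s := by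
  have hfc : ContinuousOn f (Ioo p q) := fun v hv => (hf v hv).continuousAt.continuousWithinAt
  have hmem : MapsTo (fun t => s + (q - s) * t) (Ioo (0 : ℝ) 1) (Ioo p q) :=
    fun t ht => add_sub_mul_mem_Ioo hs ht
  refine hasDerivAt_integral_of_dominated_loc_of_deriv_le
    (F := fun x t => f (x + (q - x) * t) * k t)
    (F' := fun x t => f' (x + (q - x) * t) * (1 - t) * k t)
    (bound := fun t => M * |k t|) (Ioo_mem_nhds hs.1 hs.2) ?_
    (integrableOn_comp_segment_mul hfc hM hk hs) ?_ ?_ (hk.abs.const_mul M) ?_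
  · filter_upwards [Ioo_mem_nhds hs.1 hs.2] with x hx
    exact (integrableOn_comp_segment_mul hfc hM hk hx).aestronglyMeasurable
  · exact (((hf'.comp (by fun_prop) hmem).mul (by fun_prop)).aestronglyMeasurable
      measurableSet_Ioo).mul hk.aestronglyMeasurable
  · refine ae_restrict_of_forall_mem measurableSet_Ioo fun t ht x hx => ?_
    rw [Real.norm_eq_abs, abs_mul, abs_mul]
    have h₁ := hM' _ (add_sub_mul_mem_Ioo hx ht)
    have h₂ : |1 - t| ≤ 1 := by rw [abs_le]; constructor <;> linarith [ht.1, ht.2]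
    have hM0 : 0 ≤ M := (abs_nonneg _).trans h₁
    gcongr
    calc _ ≤ M * 1 := mul_le_mul h₁ h₂ (abs_nonneg _) hM0
      _ = M := mul_one M
  · refine ae_restrict_of_forall_mem measurableSet_Ioo fun t ht x hx => ?_
    have h := (hf _ (add_sub_mul_mem_Ioo hx ht)).comp x
      ((hasDerivAt_id x).add (((hasDerivAt_id x).const_sub q).mul_const t))
    refine (h.mul_const (k t)).congr_deriv ?_
    ring

theorem integrableOn_inv_sqrt_Ioo : IntegrableOn (fun t => (√t)⁻¹) (Ioo (0 : ℝ) 1) := by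
  have h : IntegrableOn (fun t : ℝ => t ^ (-(1 / 2) : ℝ)) (Ioo 0 1) :=
    (intervalIntegral.integrableOn_Ioo_rpow_iff zero_lt_one).2 (by norm_num)
  refine h.congr_fun (fun t ht => ?_) measurableSet_Ioo
  simp only [Real.rpow_neg ht.1.le, Real.sqrt_eq_rpow]

theorem integrableOn_sqrt_Ioo : IntegrableOn (fun t => √t) (Ioo (0 : ℝ) 1) :=
  (Real.continuous_sqrt.integrableOn_Icc (a := 0) (b := 1)).mono_set Ioo_subset_Icc_self

/-- Integration by parts on a segment, against the antiderivative `(1 - t) √t`. -/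
theorem mul_integral_deriv_comp_segment_mul_sqrt {p q s M : ℝ} {f f' : ℝ → ℝ}
    (hf : ∀ v ∈ Ioo p q, HasDerivAt f (f' v) v) (hf' : ContinuousOn f' (Ioo p q))
    (hM : ∀ v ∈ Ioo p q, |f v| ≤ M) (hM' : ∀ v ∈ Ioo p q, |f' v| ≤ M) (hs : s ∈ Ioo p q) :
    (q - s) * ∫ t in Ioo (0 : ℝ) 1, f' (s + (q - s) * t) * (1 - t) * √t =
      3 / 2 * (∫ t in Ioo (0 : ℝ) 1, f (s + (q - s) * t) * √t) -
        1 / 2 * ∫ t in Ioo (0 : ℝ) 1, f (s + (q - s) * t) * (√t)⁻¹ := by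
  have hfc : ContinuousOn f (Ioo p q) := fun v hv => (hf v hv).continuousAt.continuousWithinAt
  have h₁ := (hasDerivAt_integral_comp_segment_mul hf hf' hM hM' integrableOn_sqrt_Ioo hs).1
  have h₂ := integrableOn_comp_segment_mul hfc hM integrableOn_sqrt_Ioo hs
  have h₃ := integrableOn_comp_segment_mul hfc hM integrableOn_inv_sqrt_Ioo hs
  have h₁₂ : IntegrableOn (fun t => (q - s) * (f' (s + (q - s) * t) * (1 - t) * √t)
      - 3 / 2 * (f (s + (q - s) * t) * √t)) (Ioo 0 1) :=
    (h₁.const_mul (q - s)).sub (h₂.const_mul (3 / 2))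
  have hint := h₁₂.add (h₃.const_mul (1 / 2))
  have hbd : ∀ r : ℝ, Tendsto (fun t : ℝ => |M| * |(1 - t) * √t|) (𝓝 r)
      (𝓝 (|M| * |(1 - r) * √r|)) := fun r =>
    Continuous.tendsto (by fun_prop) r
  have hle : ∀ t ∈ Ioo (0 : ℝ) 1, ‖f (s + (q - s) * t) * ((1 - t) * √t)‖ ≤
      |M| * |(1 - t) * √t| := fun t ht => by
    rw [norm_mul]
    exact mul_le_mul_of_nonneg_right ((hM _ (add_sub_mul_mem_Ioo hs ht)).trans (le_abs_self M))
      (abs_nonneg _)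
  have key := intervalIntegral.integral_eq_sub_of_hasDerivAt_of_tendsto
    (f := fun t => f (s + (q - s) * t) * ((1 - t) * √t)) (fa := 0) (fb := 0)
    (zero_lt_one' ℝ) (f' := fun t => (q - s) * (f' (s + (q - s) * t) * (1 - t) * √t)
      - 3 / 2 * (f (s + (q - s) * t) * √t) + 1 / 2 * (f (s + (q - s) * t) * (√t)⁻¹))
    (fun t ht => by
      have hd := ((hf _ (add_sub_mul_mem_Ioo hs ht)).comp t
        (((hasDerivAt_id t).const_mul (q - s)).const_add s)).mul
        (((hasDerivAt_id t).const_sub 1).mul (Real.hasDerivAt_sqrt ht.1.ne'))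
      refine hd.congr_deriv ?_
      have h0 : √t ≠ 0 := (Real.sqrt_pos.2 ht.1).ne'
      have hsq : √t ^ 2 = t := Real.sq_sqrt ht.1.le
      simp only [id, Function.comp, Pi.mul_apply]
      generalize f (s + (q - s) * t) = A
      generalize f' (s + (q - s) * t) = B
      field_simp
      linear_combination A * hsq)
    ((intervalIntegrable_iff_integrableOn_Ioo_of_le zero_le_one).2 hint)
    (squeeze_zero_norm' (by filter_upwards [Ioo_mem_nhdsGT (zero_lt_one' ℝ)] with t ht using hle t ht)
      (by simpa using (hbd 0).mono_left nhdsWithin_le_nhds))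
    (squeeze_zero_norm' (by filter_upwards [Ioo_mem_nhdsLT (zero_lt_one' ℝ)] with t ht using hle t ht)
      (by simpa using (hbd 1).mono_left nhdsWithin_le_nhds))
  rw [intervalIntegral.integral_of_le zero_le_one, integral_Ioc_eq_integral_Ioo,
    integral_add h₁₂ (h₃.const_mul _), integral_sub (h₁.const_mul _) (h₂.const_mul _),
    integral_const_mul, integral_const_mul, integral_const_mul] at key
  linarith

theorem image_segment_Ioo {s q : ℝ} (hs : s < q) :
    (fun t => s + (q - s) * t) '' Ioo 0 1 = Ioo s q := by
  have h := sub_pos.2 hs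
  ext v
  constructor
  · rintro ⟨t, ht, rfl⟩
    have h₁ := mul_pos h ht.1
    have h₂ := mul_pos h (sub_pos.2 ht.2)
    exact ⟨by linarith, by linarith⟩
  · intro hv
    refine ⟨(v - s) / (q - s), ⟨div_pos (sub_pos.2 hv.1) h, ?_⟩, ?_⟩
    · rw [div_lt_one h]; linarith [hv.2]
    · simp only; field_simp; ring

theorem integrableOn_Ioo_iff_segment {s q : ℝ} (hs : s < q) (F : ℝ → ℝ) :
    IntegrableOn F (Ioo s q) ↔
      IntegrableOn (fun t => (q - s) * F (s + (q - s) * t)) (Ioo 0 1) := by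
  have h := integrableOn_image_iff_integrableOn_abs_deriv_smul (f := fun t => s + (q - s) * t)
    (f' := fun _ => q - s) (measurableSet_Ioo (a := (0 : ℝ)) (b := 1))
    (fun t _ => by simpa using (((hasDerivAt_id t).const_mul (q - s)).const_add s).hasDerivWithinAt)
    (fun x _ y _ hxy => by simpa [(sub_pos.2 hs).ne'] using hxy) F
  rwa [image_segment_Ioo hs, abs_of_pos (sub_pos.2 hs)] at h

theorem integral_Ioo_eq_segment {s q : ℝ} (hs : s < q) (F : ℝ → ℝ) :
    ∫ v in Ioo s q, F v = ∫ t in Ioo (0 : ℝ) 1, (q - s) * F (s + (q - s) * t) := by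
  have h := integral_image_eq_integral_abs_deriv_smul (f := fun t => s + (q - s) * t)
    (f' := fun _ => q - s) (measurableSet_Ioo (a := (0 : ℝ)) (b := 1))
    (fun t _ => by simpa using (((hasDerivAt_id t).const_mul (q - s)).const_add s).hasDerivWithinAt)
    (fun x _ y _ hxy => by simpa [(sub_pos.2 hs).ne'] using hxy) F
  rwa [image_segment_Ioo hs, abs_of_pos (sub_pos.2 hs)] at h

theorem segment_div_sqrt_eq {s q t y : ℝ} (hs : s < q) :
    (q - s) * (y / √(s + (q - s) * t - s)) = √(q - s) * (y * (√t)⁻¹) := by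
  have h := sub_pos.2 hs
  have h0 := (Real.sqrt_pos.2 h).ne'
  have hsq : √(q - s) * √(q - s) = q - s := Real.mul_self_sqrt h.le
  rw [add_sub_cancel_left, Real.sqrt_mul h.le, div_eq_mul_inv, mul_inv]
  nth_rewrite 1 [← hsq]
  field_simp

theorem segment_mul_sqrt_eq {s q t y : ℝ} (hs : s < q) :
    (q - s) * (y * √(s + (q - s) * t - s)) = (q - s) * √(q - s) * (y * √t) := by
  rw [add_sub_cancel_left, Real.sqrt_mul (sub_pos.2 hs).le]
  ring

/-- The Abel transform `s ↦ ∫_s^q f(v) / √(v - s) dv` of a bounded `C¹` function with bounded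
derivative converges and is differentiable, and `s ↦ ∫_s^q f(v) √(v - s) dv` has derivative
`-1/2` times it. -/
theorem abel_transform_differentiable {p q s M : ℝ} {f f' : ℝ → ℝ}
    (hf : ∀ v ∈ Ioo p q, HasDerivAt f (f' v) v) (hf' : ContinuousOn f' (Ioo p q))
    (hM : ∀ v ∈ Ioo p q, |f v| ≤ M) (hM' : ∀ v ∈ Ioo p q, |f' v| ≤ M) (hs : s ∈ Ioo p q) :
    IntegrableOn (fun v => f v / √(v - s)) (Ioo s q) ∧
    IntegrableOn (fun v => f v * √(v - s)) (Ioo s q) ∧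
    DifferentiableAt ℝ (fun x => ∫ v in Ioo x q, f v / √(v - x)) s ∧
    HasDerivAt (fun x => ∫ v in Ioo x q, f v * √(v - x))
      (-(1 / 2) * ∫ v in Ioo s q, f v / √(v - s)) s := by
  have hfc : ContinuousOn f (Ioo p q) := fun v hv => (hf v hv).continuousAt.continuousWithinAt
  have hJ : ∀ x ∈ Ioo p q, ∫ v in Ioo x q, f v / √(v - x) =
      √(q - x) * ∫ t in Ioo (0 : ℝ) 1, f (x + (q - x) * t) * (√t)⁻¹ := fun x hx => by
    rw [integral_Ioo_eq_segment hx.2]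
    simp_rw [segment_div_sqrt_eq hx.2]
    rw [integral_const_mul]
  have hK : ∀ x ∈ Ioo p q, ∫ v in Ioo x q, f v * √(v - x) =
      (q - x) * √(q - x) * ∫ t in Ioo (0 : ℝ) 1, f (x + (q - x) * t) * √t := fun x hx => by
    rw [integral_Ioo_eq_segment hx.2]
    simp_rw [segment_mul_sqrt_eq hx.2]
    rw [integral_const_mul]
  have hnhds := Ioo_mem_nhds hs.1 hs.2
  have hq := sub_pos.2 hs.2
  have hlin : HasDerivAt (fun x => q - x) (-1) s := (hasDerivAt_id s).const_sub q
  have hsqrt := hlin.sqrt hq.ne'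
  refine ⟨?_, ?_, ?_, ?_⟩
  · rw [integrableOn_Ioo_iff_segment hs.2]
    simp_rw [segment_div_sqrt_eq hs.2]
    exact (integrableOn_comp_segment_mul hfc hM integrableOn_inv_sqrt_Ioo hs).const_mul _
  · rw [integrableOn_Ioo_iff_segment hs.2]
    simp_rw [segment_mul_sqrt_eq hs.2]
    exact (integrableOn_comp_segment_mul hfc hM integrableOn_sqrt_Ioo hs).const_mul _
  · refine DifferentiableAt.congr_of_eventuallyEq ?_ (eventually_of_mem hnhds hJ)
    exact hsqrt.differentiableAt.mul (hasDerivAt_integral_comp_segment_mul hf hf' hM hM'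
      integrableOn_inv_sqrt_Ioo hs).2.differentiableAt
  · refine HasDerivAt.congr_of_eventuallyEq ?_ (eventually_of_mem hnhds hK)
    refine ((hlin.mul hsqrt).mul (hasDerivAt_integral_comp_segment_mul hf hf' hM hM'
      integrableOn_sqrt_Ioo hs).2).congr_deriv ?_
    have hparts := mul_integral_deriv_comp_segment_mul_sqrt hf hf' hM hM' hs
    have h0 : √(q - s) ≠ 0 := (Real.sqrt_pos.2 hq).ne'
    have hsq : √(q - s) ^ 2 = q - s := Real.sq_sqrt hq.le
    have hdiv : (q - s) * (-1 / (2 * √(q - s))) = -(1 / 2) * √(q - s) := by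
      field_simp
      linear_combination hsq
    simp only [Pi.mul_apply]
    rw [hJ s hs, hdiv]
    linear_combination √(q - s) * hparts

section Inverse

variable {a b : ℝ} {V V' W : ℝ → ℝ}

theorem image_Ioo_eq_of_rightInverse (hmono : StrictMonoOn V (Icc a b))
    (hW : ∀ v ∈ Ioo (V a) (V b), W v ∈ Ioo a b ∧ V (W v) = v) {x : ℝ} (hx : x ∈ Ico a b) :
    V '' Ioo x b = Ioo (V x) (V b) := by
  have hab : a ≤ b := hx.1.trans hx.2.le
  have hxI : x ∈ Icc a b := Ico_subset_Icc_self hx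
  ext v
  constructor
  · rintro ⟨η, hη, rfl⟩
    have hηI : η ∈ Icc a b := ⟨hx.1.trans hη.1.le, hη.2.le⟩
    exact ⟨hmono hxI hηI hη.1, hmono hηI (right_mem_Icc.2 hab) hη.2⟩
  · intro hv
    have hax := hmono.monotoneOn (left_mem_Icc.2 hab) hxI hx.1
    obtain ⟨h₁, h₂⟩ := hW v ⟨hax.trans_lt hv.1, hv.2⟩
    refine ⟨W v, ⟨?_, h₁.2⟩, h₂⟩
    rw [← hmono.lt_iff_lt hxI (Ioo_subset_Icc_self h₁), h₂]
    exact hv.1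

theorem hasDerivAt_of_rightInverse (hmono : StrictMonoOn V (Icc a b))
    (hV : ∀ η ∈ Ioo a b, HasDerivAt V (V' η) η) (hV' : ∀ η ∈ Ioo a b, V' η ≠ 0)
    (hW : ∀ v ∈ Ioo (V a) (V b), W v ∈ Ioo a b ∧ V (W v) = v) {v : ℝ}
    (hv : v ∈ Ioo (V a) (V b)) : HasDerivAt W (V' (W v))⁻¹ v := by
  have hnhds := Ioo_mem_nhds hv.1 hv.2
  have hWmono : StrictMonoOn W (Ioo (V a) (V b)) := fun x hx y hy hxy => by
    rw [← hmono.lt_iff_lt (Ioo_subset_Icc_self (hW x hx).1) (Ioo_subset_Icc_self (hW y hy).1),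
      (hW x hx).2, (hW y hy).2]
    exact hxy
  have himage : Ioo a b ⊆ W '' Ioo (V a) (V b) := fun η hη => by
    have hηI := Ioo_subset_Icc_self hη
    have hab := hη.1.le.trans hη.2.le
    have hVη : V η ∈ Ioo (V a) (V b) :=
      ⟨hmono (left_mem_Icc.2 hab) hηI hη.1, hmono hηI (right_mem_Icc.2 hab) hη.2⟩
    exact ⟨V η, hVη, hmono.injOn (Ioo_subset_Icc_self (hW _ hVη).1) hηI (hW _ hVη).2⟩
  have hWv := (hW v hv).1
  exact HasDerivAt.of_local_left_inverse (hWmono.continuousAt_of_image_mem_nhds hnhds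
    (mem_of_superset (Ioo_mem_nhds hWv.1 hWv.2) himage)) (hV _ hWv) (hV' _ hWv)
    (eventually_of_mem hnhds fun y hy => (hW y hy).2)

end Inverse

/-- Non-zero-temperature bulk-building relation: with `V` twice continuously differentiable,
increasing and positive on `[a, η₁]`, `g` continuously differentiable and positive,
`η₀ h₀` the unique point where `V = h₀²`, and
`Ẽ h₀ = ∫_{η₀ h₀}^{η₁} (1/√g)·V/√(V − h₀²) dη`,
`R̃ h₀ = ∫_{η₀ h₀}^{η₁} (1/√g)·h₀/√(V − h₀²) dη`, both improper integrals converge,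
`Ẽ` and `R̃` are differentiable on `(√(V a), √(V η₁))`, and `Ẽ' h₀ = h₀ · R̃' h₀`. -/
theorem stmt_8 (a η₁ : ℝ) (haη : a < η₁)
    (V V' V'' : ℝ → ℝ)
    (hV : ∀ η ∈ Set.Icc a η₁, HasDerivAt V (V' η) η)
    (hV' : ∀ η ∈ Set.Icc a η₁, HasDerivAt V' (V'' η) η)
    (hV'' : ContinuousOn V'' (Set.Icc a η₁))
    (hder : ∀ η ∈ Set.Icc a η₁, 0 < V' η)
    (hpos : ∀ η ∈ Set.Icc a η₁, 0 < V η)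
    (g g' : ℝ → ℝ)
    (hg : ∀ η ∈ Set.Icc a η₁, HasDerivAt g (g' η) η)
    (hg' : ContinuousOn g' (Set.Icc a η₁))
    (hgpos : ∀ η ∈ Set.Icc a η₁, 0 < g η)
    (η₀ : ℝ → ℝ)
    (hη₀ : ∀ h₀ ∈ Set.Ioo (Real.sqrt (V a)) (Real.sqrt (V η₁)),
      η₀ h₀ ∈ Set.Ioo a η₁ ∧ V (η₀ h₀) = h₀ ^ 2) :
    ∀ h₀ ∈ Set.Ioo (Real.sqrt (V a)) (Real.sqrt (V η₁)),
      IntegrableOn (fun η => 1 / Real.sqrt (g η) * (V η / Real.sqrt (V η - h₀ ^ 2)))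
        (Set.Ioo (η₀ h₀) η₁) ∧
      IntegrableOn (fun η => 1 / Real.sqrt (g η) * (h₀ / Real.sqrt (V η - h₀ ^ 2)))
        (Set.Ioo (η₀ h₀) η₁) ∧
      DifferentiableAt ℝ
        (fun u => ∫ η in Set.Ioo (η₀ u) η₁,
          1 / Real.sqrt (g η) * (V η / Real.sqrt (V η - u ^ 2))) h₀ ∧
      DifferentiableAt ℝ
        (fun u => ∫ η in Set.Ioo (η₀ u) η₁,
          1 / Real.sqrt (g η) * (u / Real.sqrt (V η - u ^ 2))) h₀ ∧
      deriv (fun u => ∫ η in Set.Ioo (η₀ u) η₁,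
          1 / Real.sqrt (g η) * (V η / Real.sqrt (V η - u ^ 2))) h₀ =
        h₀ * deriv (fun u => ∫ η in Set.Ioo (η₀ u) η₁,
          1 / Real.sqrt (g η) * (u / Real.sqrt (V η - u ^ 2))) h₀ := by
  have hcV : ContinuousOn V (Set.Icc a η₁) := fun x hx => (hV x hx).continuousAt.continuousWithinAt
  have hcV' : ContinuousOn V' (Set.Icc a η₁) :=
    fun x hx => (hV' x hx).continuousAt.continuousWithinAt
  have hcg : ContinuousOn g (Set.Icc a η₁) := fun x hx => (hg x hx).continuousAt.continuousWithinAt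
  have hmono : StrictMonoOn V (Set.Icc a η₁) :=
    strictMonoOn_of_deriv_pos (convex_Icc a η₁) hcV fun x hx => by
      rw [interior_Icc] at hx
      rw [(hV x (Ioo_subset_Icc_self hx)).deriv]
      exact hder x (Ioo_subset_Icc_self hx)
  have hVa := hpos a (left_mem_Icc.2 haη.le)
  set W : ℝ → ℝ := fun v => η₀ (√v)
  have hW : ∀ v ∈ Set.Ioo (V a) (V η₁), W v ∈ Set.Ioo a η₁ ∧ V (W v) = v := fun v hv => by
    have hv0 := hVa.trans hv.1
    have h := hη₀ (√v) ⟨Real.sqrt_lt_sqrt hVa.le hv.1, Real.sqrt_lt_sqrt hv0.le hv.2⟩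
    rwa [Real.sq_sqrt hv0.le] at h
  have hWV : ∀ η ∈ Set.Ioo a η₁, W (V η) = η := fun η hη => by
    have hηI := Ioo_subset_Icc_self hη
    have h := hW (V η) ⟨hmono (left_mem_Icc.2 haη.le) hηI hη.1,
      hmono hηI (right_mem_Icc.2 haη.le) hη.2⟩
    exact hmono.injOn (Ioo_subset_Icc_self h.1) hηI h.2
  have hWd : ∀ v ∈ Set.Ioo (V a) (V η₁), HasDerivAt W (V' (W v))⁻¹ v := fun v hv =>
    hasDerivAt_of_rightInverse hmono (fun η hη => hV η (Ioo_subset_Icc_self hη))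
      (fun η hη => (hder η (Ioo_subset_Icc_self hη)).ne') hW hv
  have hWmaps : Set.MapsTo W (Set.Ioo (V a) (V η₁)) (Set.Icc a η₁) :=
    fun v hv => Ioo_subset_Icc_self (hW v hv).1
  have hcW : ContinuousOn W (Set.Ioo (V a) (V η₁)) :=
    fun v hv => (hWd v hv).continuousAt.continuousWithinAt
  -- the density `1 / (√g V')` of the integrals with respect to `dV`
  set φ : ℝ → ℝ := fun η => (√(g η) * V' η)⁻¹ with hφdef
  set φ' : ℝ → ℝ := fun η =>
    -(g' η / (2 * √(g η)) * V' η + √(g η) * V'' η) / (√(g η) * V' η) ^ 2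
  have hden : ∀ η ∈ Set.Icc a η₁, √(g η) * V' η ≠ 0 := fun η hη =>
    (mul_pos (Real.sqrt_pos.2 (hgpos η hη)) (hder η hη)).ne'
  have hφ : ∀ η ∈ Set.Icc a η₁, HasDerivAt φ (φ' η) η := fun η hη =>
    (((hg η hη).sqrt (hgpos η hη).ne').mul (hV' η hη)).fun_inv (hden η hη)
  have hcφ : ContinuousOn φ (Set.Icc a η₁) := fun x hx => (hφ x hx).continuousAt.continuousWithinAt
  have hcφ' : ContinuousOn (fun η => φ' η * (V' η)⁻¹) (Set.Icc a η₁) := by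
    refine ContinuousOn.mul (ContinuousOn.div ?_ ((hcg.sqrt.mul hcV').pow 2)
      fun η hη => pow_ne_zero 2 (hden η hη)) (hcV'.inv₀ fun η hη => (hder η hη).ne')
    exact (((hg'.div (hcg.sqrt.const_mul 2) fun η hη =>
      mul_ne_zero two_ne_zero (Real.sqrt_pos.2 (hgpos η hη)).ne').mul hcV').add
        (hcg.sqrt.mul hV'')).neg
  obtain ⟨M₁, hM₁⟩ := isCompact_Icc.exists_bound_of_continuousOn hcφ
  obtain ⟨M₂, hM₂⟩ := isCompact_Icc.exists_bound_of_continuousOn hcφ'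
  have habel := fun s (hs : s ∈ Set.Ioo (V a) (V η₁)) =>
    abel_transform_differentiable (f := φ ∘ W) (f' := (fun η => φ' η * (V' η)⁻¹) ∘ W)
      (M := max M₁ M₂) (fun v hv => (hφ _ (hWmaps hv)).comp v (hWd v hv)) (hcφ'.comp hcW hWmaps)
      (fun v hv => (hM₁ _ (hWmaps hv)).trans (le_max_left _ _))
      (fun v hv => (hM₂ _ (hWmaps hv)).trans (le_max_right _ _)) hs
  have hsq : ∀ u ∈ Set.Ioo (√(V a)) (√(V η₁)), u ^ 2 ∈ Set.Ioo (V a) (V η₁) := fun u hu => by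
    have h := (hη₀ u hu).1
    rw [← (hη₀ u hu).2]
    exact ⟨hmono (left_mem_Icc.2 haη.le) (Ioo_subset_Icc_self h) h.1,
      hmono (Ioo_subset_Icc_self h) (right_mem_Icc.2 haη.le) h.2⟩
  -- change of variables `v = V η`
  have himg : ∀ u ∈ Set.Ioo (√(V a)) (√(V η₁)),
      V '' Set.Ioo (η₀ u) η₁ = Set.Ioo (u ^ 2) (V η₁) := fun u hu => by
    obtain ⟨h₁, h₂⟩ := hη₀ u hu
    rw [image_Ioo_eq_of_rightInverse hmono hW (Ioo_subset_Ico_self h₁), h₂]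
  have hsub : ∀ u ∈ Set.Ioo (√(V a)) (√(V η₁)), Set.Ioo (η₀ u) η₁ ⊆ Set.Ioo a η₁ := fun u hu =>
    Set.Ioo_subset_Ioo_left (hη₀ u hu).1.1.le
  have hVsub : ∀ u ∈ Set.Ioo (√(V a)) (√(V η₁)), ∀ η ∈ Set.Ioo (η₀ u) η₁,
      HasDerivWithinAt V (V' η) (Set.Ioo (η₀ u) η₁) η := fun u hu η hη =>
    (hV η (Ioo_subset_Icc_self (hsub u hu hη))).hasDerivWithinAt
  have hinj : ∀ u ∈ Set.Ioo (√(V a)) (√(V η₁)), Set.InjOn V (Set.Ioo (η₀ u) η₁) := fun u hu =>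
    hmono.injOn.mono ((hsub u hu).trans Ioo_subset_Icc_self)
  have hweight : ∀ u ∈ Set.Ioo (√(V a)) (√(V η₁)), ∀ G : ℝ → ℝ, ∀ η ∈ Set.Ioo (η₀ u) η₁,
      |V' η| • (φ (W (V η)) * G (V η)) = 1 / √(g η) * G (V η) := fun u hu G η hη => by
    have hη' := hsub u hu hη
    have hd := hder η (Ioo_subset_Icc_self hη')
    rw [hWV η hη', abs_of_pos hd, smul_eq_mul, hφdef]
    simp only
    rw [mul_inv]
    field_simp
  have hcvI : ∀ u ∈ Set.Ioo (√(V a)) (√(V η₁)), ∀ G : ℝ → ℝ,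
      IntegrableOn (fun v => φ (W v) * G v) (Set.Ioo (u ^ 2) (V η₁)) →
      IntegrableOn (fun η => 1 / √(g η) * G (V η)) (Set.Ioo (η₀ u) η₁) := fun u hu G h => by
    rw [← himg u hu, integrableOn_image_iff_integrableOn_abs_deriv_smul measurableSet_Ioo
      (hVsub u hu) (hinj u hu)] at h
    exact h.congr_fun (hweight u hu G) measurableSet_Ioo
  have hcv : ∀ u ∈ Set.Ioo (√(V a)) (√(V η₁)), ∀ G : ℝ → ℝ,
      ∫ η in Set.Ioo (η₀ u) η₁, 1 / √(g η) * G (V η) =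
        ∫ v in Set.Ioo (u ^ 2) (V η₁), φ (W v) * G v := fun u hu G => by
    rw [← himg u hu, integral_image_eq_integral_abs_deriv_smul measurableSet_Ioo
      (hVsub u hu) (hinj u hu)]
    exact (setIntegral_congr_fun measurableSet_Ioo (hweight u hu G)).symm
  set J : ℝ → ℝ := fun s => ∫ v in Set.Ioo s (V η₁), (φ ∘ W) v / √(v - s) with hJdef
  set K : ℝ → ℝ := fun s => ∫ v in Set.Ioo s (V η₁), (φ ∘ W) v * √(v - s)
  have hsplit : ∀ s, ∀ v ∈ Set.Ioo s (V η₁),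
      (φ ∘ W) v * √(v - s) + s * ((φ ∘ W) v / √(v - s)) = φ (W v) * (v / √(v - s)) :=
    fun s v hv => by
      have h := sub_pos.2 hv.1
      have h0 := (Real.sqrt_pos.2 h).ne'
      have h2 : √(v - s) ^ 2 = v - s := Real.sq_sqrt h.le
      simp only [Function.comp]
      generalize φ (W v) = A
      field_simp
      linear_combination A * h2
  have hR : ∀ u ∈ Set.Ioo (√(V a)) (√(V η₁)),
      ∫ η in Set.Ioo (η₀ u) η₁, 1 / √(g η) * (u / √(V η - u ^ 2)) = u * J (u ^ 2) :=
    fun u hu => by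
      rw [hcv u hu (fun v => u / √(v - u ^ 2)), hJdef]
      simp only
      rw [← integral_const_mul]
      congr 1 with v
      simp only [Function.comp]
      ring
  have hE : ∀ u ∈ Set.Ioo (√(V a)) (√(V η₁)),
      ∫ η in Set.Ioo (η₀ u) η₁, 1 / √(g η) * (V η / √(V η - u ^ 2)) =
        K (u ^ 2) + u ^ 2 * J (u ^ 2) := fun u hu => by
    obtain ⟨hi₁, hi₂, -⟩ := habel _ (hsq u hu)
    rw [hcv u hu (fun v => v / √(v - u ^ 2)),
      ← setIntegral_congr_fun measurableSet_Ioo (hsplit (u ^ 2)),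
      integral_add hi₂ (hi₁.const_mul _), integral_const_mul]
  intro u hu
  obtain ⟨hi₁, hi₂, hJd, hKd⟩ := habel _ (hsq u hu)
  have hnhds := Ioo_mem_nhds hu.1 hu.2
  have hpow : HasDerivAt (fun x : ℝ => x ^ 2) (2 * u) u := by simpa using hasDerivAt_pow 2 u
  have hJu : HasDerivAt (fun x => J (x ^ 2)) (deriv J (u ^ 2) * (2 * u)) u :=
    HasDerivAt.comp (h₂ := J) (h := fun x => x ^ 2) u hJd.hasDerivAt hpow
  have hKu : HasDerivAt (fun x => K (x ^ 2)) (-(1 / 2) * J (u ^ 2) * (2 * u)) u :=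
    HasDerivAt.comp (h₂ := K) (h := fun x => x ^ 2) u hKd hpow
  have hRd := ((hasDerivAt_id u).mul hJu).congr_of_eventuallyEq (eventually_of_mem hnhds hR)
  have hEd := (hKu.add (hpow.mul hJu)).congr_of_eventuallyEq (eventually_of_mem hnhds hE)
  refine ⟨?_, ?_, hEd.differentiableAt, hRd.differentiableAt, ?_⟩
  · exact hcvI u hu (fun v => v / √(v - u ^ 2))
      (IntegrableOn.congr_fun (hi₂.add (hi₁.const_mul (u ^ 2))) (hsplit (u ^ 2)) measurableSet_Ioo)
  · refine hcvI u hu (fun v => u / √(v - u ^ 2)) (IntegrableOn.congr_fun (hi₁.const_mul u)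
      (fun v _ => ?_) measurableSet_Ioo)
    simp only [Function.comp]
    ring
  · rw [hEd.deriv, hRd.deriv]
    simp only [id]
    ring
end

section
/- Let C > 0 and let n > 2 be real, and define R(f₀) := C·f₀^{−1/n} for f₀ > 0. Then for every f > 0 the quantity Φ(f) := −(1/π)·√f·(d/df) ∫_f^∞ R(f₀)/√(f₀² − f²) df₀ is well defined and equals (C·Γ(1/(2n))/(2n·√π·Γ(1/(2n) + 1/2)))·f^{−1/2 − 1/n}; consequently any function η with η'(f) = Φ(f) on (0,∞) satisfies η(f) = B·f^{(n−2)/(2n)} + const with B := C·Γ(1/(2n))·n/((n−2)·n·√π·Γ(1/(2n)+1/2)) · ... explicitly B = (2n/(n−2))·(C·Γ(1/(2n))/(2n√π·Γ(1/(2n)+1/2))), and its inverse function has the power-law form f(η) = ((η − η₀)/B)^{2n/(n−2)}. -/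
open MeasureTheory

/-- `G12 C n f = ∫_f^∞ R(f₀)/√(f₀² − f²) df₀` with `R(f₀) = C·f₀^(−1/n)`. -/
noncomputable def G12 (C n : ℝ) (f : ℝ) : ℝ :=
  ∫ f₀ in Set.Ioi f, C * f₀ ^ (-(1 : ℝ) / n) / Real.sqrt (f₀ ^ 2 - f ^ 2)

/-- The coefficient `A = C·Γ(1/(2n))/(2n·√π·Γ(1/(2n) + 1/2))`. -/
noncomputable def A12 (C n : ℝ) : ℝ :=
  C * Real.Gamma (1 / (2 * n)) /
    (2 * n * Real.sqrt Real.pi * Real.Gamma (1 / (2 * n) + 1 / 2))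

/-- The coefficient `B = (2n/(n−2))·A`. -/
noncomputable def B12 (C n : ℝ) : ℝ := 2 * n / (n - 2) * A12 C n

theorem integral_Ioo_rpow_mul_one_sub_rpow {a b : ℝ} (ha : 0 < a) (hb : 0 < b) :
    ∫ x in Set.Ioo (0 : ℝ) 1, x ^ (a - 1) * (1 - x) ^ (b - 1) =
      Real.Gamma a * Real.Gamma b / Real.Gamma (a + b) := by
  have h := Complex.betaIntegral_eq_Gamma_mul_div (a : ℂ) (b : ℂ) (by simpa) (by simpa)
  rw [Complex.betaIntegral, intervalIntegral.integral_of_le zero_le_one,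
    integral_Ioc_eq_integral_Ioo] at h
  have hreal : ∫ x in Set.Ioo (0 : ℝ) 1,
      (x : ℂ) ^ ((a : ℂ) - 1) * (1 - (x : ℂ)) ^ ((b : ℂ) - 1) =
      ((∫ x in Set.Ioo (0 : ℝ) 1, x ^ (a - 1) * (1 - x) ^ (b - 1) : ℝ) : ℂ) := by
    rw [← integral_complex_ofReal]
    refine setIntegral_congr_fun measurableSet_Ioo fun x hx => ?_
    simp only [Complex.ofReal_mul]
    rw [Complex.ofReal_cpow hx.1.le, Complex.ofReal_cpow (sub_nonneg.2 hx.2.le)]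
    push_cast
    rfl
  rw [hreal, ← Complex.ofReal_add, Complex.Gamma_ofReal, Complex.Gamma_ofReal,
    Complex.Gamma_ofReal] at h
  exact_mod_cast h

theorem integral_Ioi_one_rpow_div_sqrt {s : ℝ} (hs : 0 < s) :
    ∫ x in Set.Ioi (1 : ℝ), x ^ (-s) / √(x ^ 2 - 1) =
      √Real.pi * Real.Gamma (s / 2) / (2 * Real.Gamma (s / 2 + 1 / 2)) := by
  have hlt : ∀ x ∈ Set.Ioi (0 : ℝ), (1 < x ^ (-(1 / 2) : ℝ) ↔ x < 1) := fun x hx =>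
    ⟨fun h => by
      by_contra! hx1
      exact absurd h (Real.rpow_le_one_of_one_le_of_nonpos hx1 (by norm_num)).not_gt,
    fun h => Real.one_lt_rpow_of_pos_of_lt_one_of_neg hx h (by norm_num)⟩
  calc ∫ x in Set.Ioi (1 : ℝ), x ^ (-s) / √(x ^ 2 - 1)
      = ∫ x in Set.Ioi (0 : ℝ),
          (Set.Ioi (1 : ℝ)).indicator (fun x => x ^ (-s) / √(x ^ 2 - 1)) x := by
        rw [setIntegral_indicator measurableSet_Ioi, Set.Ioi_inter_Ioi,
          sup_eq_right.2 zero_le_one]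
    _ = ∫ x in Set.Ioi (0 : ℝ), (Set.Iio (1 : ℝ)).indicator
          (fun x => 1 / 2 * (x ^ (s / 2 - 1) * (1 - x) ^ ((1 / 2 : ℝ) - 1))) x := by
        rw [← integral_comp_rpow_Ioi _ (p := -(1 / 2)) (by norm_num)]
        refine setIntegral_congr_fun measurableSet_Ioi fun x hx => ?_
        have hx0 : 0 < x := hx
        by_cases hx1 : x < 1
        · have h1x : 0 < 1 - x := sub_pos.2 hx1
          have hsqrt : √((x ^ (-(1 / 2) : ℝ)) ^ 2 - 1) =
              x ^ (-(1 / 2) : ℝ) * (1 - x) ^ (1 / 2 : ℝ) := by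
            rw [Real.sqrt_eq_iff_eq_sq _ (by positivity), mul_pow,
              ← Real.rpow_natCast ((1 - x) ^ _), ← Real.rpow_mul h1x.le,
              ← Real.rpow_natCast, ← Real.rpow_mul hx0.le]
            · norm_num [Real.rpow_neg_one]
              field_simp
            · exact sub_nonneg.2 (one_le_pow₀ ((hlt x hx).2 hx1).le)
          simp only [smul_eq_mul]
          rw [Set.indicator_of_mem (show _ ∈ Set.Ioi (1 : ℝ) from (hlt x hx).2 hx1),
            Set.indicator_of_mem (show x ∈ Set.Iio (1 : ℝ) from hx1), hsqrt,
            ← Real.rpow_mul hx0.le, abs_of_neg (by norm_num), neg_neg,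
            Real.rpow_sub hx0 (-(1 / 2)) 1,
            show s / 2 - 1 = -(1 / 2) * -s - 1 by ring, Real.rpow_sub hx0 _ 1,
            show (1 / 2 : ℝ) - 1 = -(1 / 2) by norm_num, Real.rpow_neg h1x.le]
          have := (Real.rpow_pos_of_pos hx0 (-(1 / 2))).ne'
          have := (Real.rpow_pos_of_pos h1x (1 / 2)).ne'
          field_simp
        · simp only [smul_eq_mul]
          rw [Set.indicator_of_notMem (show _ ∉ Set.Ioi (1 : ℝ) from mt (hlt x hx).1 hx1),
            Set.indicator_of_notMem (show x ∉ Set.Iio (1 : ℝ) from hx1), mul_zero]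
    _ = _ := by
        rw [setIntegral_indicator measurableSet_Iio, Set.Ioi_inter_Iio, integral_const_mul,
          integral_Ioo_rpow_mul_one_sub_rpow (by positivity) (by norm_num),
          Real.Gamma_one_half_eq]
        ring

theorem G12_eq_mul_rpow {C n f : ℝ} (hn : 0 < n) (hf : 0 < f) :
    G12 C n f = Real.pi * n * A12 C n * f ^ (-(1 : ℝ) / n) := by
  have hscale := integral_comp_mul_left_Ioi'
    (fun x : ℝ => C * x ^ (-(1 : ℝ) / n) / √(x ^ 2 - f ^ 2)) 1 hf
  rw [mul_one] at hscale
  have hcongr : ∀ x ∈ Set.Ioi (1 : ℝ),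
      C * (f * x) ^ (-(1 : ℝ) / n) / √((f * x) ^ 2 - f ^ 2) =
        C * f ^ (-(1 : ℝ) / n) / f * (x ^ (-(1 / n)) / √(x ^ 2 - 1)) := fun x hx => by
    have hx0 : 0 < x := zero_lt_one.trans hx
    rw [show (f * x) ^ 2 - f ^ 2 = f ^ 2 * (x ^ 2 - 1) by ring,
      Real.sqrt_mul (sq_nonneg f), Real.sqrt_sq hf.le, Real.mul_rpow hf.le hx0.le,
      neg_div]
    ring
  rw [G12, ← hscale, setIntegral_congr_fun measurableSet_Ioi hcongr, integral_const_mul,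
    integral_Ioi_one_rpow_div_sqrt (by positivity), A12, smul_eq_mul, div_div,
    mul_comm n 2]
  have hΓ : Real.Gamma (1 / (2 * n) + 1 / 2) ≠ 0 := (Real.Gamma_pos_of_pos (by positivity)).ne'
  have hpi : √Real.pi ≠ 0 := (Real.sqrt_pos.2 Real.pi_pos).ne'
  generalize Real.Gamma (1 / (2 * n) + 1 / 2) = b at *
  generalize Real.Gamma (1 / (2 * n)) = a
  generalize f ^ (-(1 : ℝ) / n) = c
  nth_rewrite 2 [← Real.sq_sqrt Real.pi_pos.le]
  field_simp

theorem hasDerivAt_G12 {C n f : ℝ} (hn : 0 < n) (hf : 0 < f) :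
    HasDerivAt (G12 C n) (-(Real.pi * A12 C n * f ^ (-(1 : ℝ) / n - 1))) f := by
  refine (((Real.hasDerivAt_rpow_const (p := -(1 : ℝ) / n) (Or.inl hf.ne')).const_mul
    (Real.pi * n * A12 C n)).congr_of_eventuallyEq ?_).congr_deriv ?_
  · filter_upwards [Ioi_mem_nhds hf] with x hx using G12_eq_mul_rpow hn hx
  · field_simp

theorem neg_sqrt_mul_deriv_G12 {C n f : ℝ} (hn : 0 < n) (hf : 0 < f) :
    -(1 / Real.pi) * Real.sqrt f * deriv (G12 C n) f =
      A12 C n * f ^ (-(1 : ℝ) / 2 - 1 / n) := by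
  rw [(hasDerivAt_G12 hn hf).deriv, Real.sqrt_eq_rpow,
    show -(1 : ℝ) / 2 - 1 / n = 1 / 2 + (-(1 : ℝ) / n - 1) by ring, Real.rpow_add hf]
  have := Real.pi_ne_zero
  field_simp

theorem A12_pos {C n : ℝ} (hC : 0 < C) (hn : 0 < n) : 0 < A12 C n :=
  div_pos (mul_pos hC (Real.Gamma_pos_of_pos (by positivity)))
    (mul_pos (mul_pos (by positivity) (Real.sqrt_pos.2 Real.pi_pos))
      (Real.Gamma_pos_of_pos (by positivity)))

theorem B12_pos {C n : ℝ} (hC : 0 < C) (hn : 2 < n) : 0 < B12 C n :=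
  mul_pos (div_pos (by linarith) (sub_pos.2 hn)) (A12_pos hC (by linarith))

/-- For the power-law potential data `R(f₀) = C·f₀^(−1/n)` with `n > 2`, the quantity
`Φ f = −(1/π)·√f·(d/df)∫_f^∞ R(f₀)/√(f₀² − f²) df₀` is well defined and equals
`A·f^(−1/2 − 1/n)`; consequently any `η` with `η' = Φ` on `(0, ∞)` satisfies
`η f = B·f^((n−2)/(2n)) + η₀`, with inverse of power-law form
`f(η) = ((η − η₀)/B)^(2n/(n−2))`. -/
theorem stmt_12 (C n : ℝ) (hC : 0 < C) (hn : 2 < n) :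
    (∀ f : ℝ, 0 < f →
      DifferentiableAt ℝ (G12 C n) f ∧
      -(1 / Real.pi) * Real.sqrt f * deriv (G12 C n) f =
        A12 C n * f ^ (-(1 : ℝ) / 2 - 1 / n)) ∧
    ∀ η : ℝ → ℝ,
      (∀ f : ℝ, 0 < f →
        HasDerivAt η (-(1 / Real.pi) * Real.sqrt f * deriv (G12 C n) f) f) →
      ∃ η₀ : ℝ, ∀ f : ℝ, 0 < f →
        η f = B12 C n * f ^ ((n - 2) / (2 * n)) + η₀ ∧
        ((η f - η₀) / B12 C n) ^ (2 * n / (n - 2)) = f := by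
  have hn0 : 0 < n := by linarith
  have hn2 : 0 < n - 2 := sub_pos.2 hn
  refine ⟨fun f hf => ⟨(hasDerivAt_G12 hn0 hf).differentiableAt,
    neg_sqrt_mul_deriv_G12 hn0 hf⟩, fun η hη => ?_⟩
  have hpow : ∀ f : ℝ, 0 < f → HasDerivAt (fun f => B12 C n * f ^ ((n - 2) / (2 * n)))
      (-(1 / Real.pi) * Real.sqrt f * deriv (G12 C n) f) f := fun f hf => by
    refine ((Real.hasDerivAt_rpow_const (p := (n - 2) / (2 * n)) (Or.inl hf.ne')).const_mul
      (B12 C n)).congr_deriv ?_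
    rw [neg_sqrt_mul_deriv_G12 hn0 hf, B12,
      show (n - 2) / (2 * n) - 1 = -(1 : ℝ) / 2 - 1 / n by field_simp; ring]
    field_simp
  obtain ⟨η₀, hη₀⟩ := isOpen_Ioi.exists_eq_add_of_deriv_eq (isPreconnected_Ioi (a := (0 : ℝ)))
    (fun f hf => (hη f hf).differentiableAt.differentiableWithinAt)
    (fun f hf => (hpow f hf).differentiableAt.differentiableWithinAt)
    (fun f hf => (hη f hf).deriv.trans (hpow f hf).deriv.symm)
  refine ⟨η₀, fun f hf => ⟨hη₀ hf, ?_⟩⟩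
  rw [hη₀ hf]
  simp only
  rw [add_sub_cancel_right, mul_div_cancel_left₀ _ (B12_pos hC hn).ne', ← Real.rpow_mul hf.le,
    show (n - 2) / (2 * n) * (2 * n / (n - 2)) = 1 by field_simp, Real.rpow_one]
end
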